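/- Under the uniform random error model over F_q with t nonzero error columns uniform over (F_q^L)\{0}, for t ≤ t_max = (L/(L+1))(N-K), the probability of decoding failure of the collaborative IRS decoder satisfies P_F(t) ≤ ((q^L - 1/q)/(q^L - 1)) · q^{-(L+1)(t_max - t)}/(q - 1); in particular P_F(t) → 0 as q → ∞ for all t ≤ t_max. -/

import Mathlib

theorem card_nonzero {V : Type*} [Zero V] [Fintype V] [Fintype {v : V // v ≠ 0}] :
    (Fintype.card {v : V // v ≠ 0} : ℝ) = Fintype.card V - 1 := by
  classical
  have h := Fintype.card_subtype_compl (fun v : V => v = 0)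
  have h1 : 1 ≤ Fintype.card V := Fintype.card_pos
  simp only [Fintype.card_unique] at h
  rw [← Nat.cast_one, ← Nat.cast_sub h1, ← h]

open scoped Classical in
/-- Summing `g` over all products `u • e` of a scalar and a nonzero vector. -/
theorem sum_smul_nonzero {F V : Type*} [Field F] [Fintype F] [AddCommGroup V] [Module F V]
    [Fintype V] [Fintype {v : V // v ≠ 0}] (g : V → ℝ) :
    ∑ z : F × {v : V // v ≠ 0}, g (z.1 • (z.2 : V)) =
      ((Fintype.card V : ℝ) - Fintype.card F) * g 0 + ((Fintype.card F : ℝ) - 1) * ∑ v, g v := by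
  have hunit (u : F) (hu : u ≠ 0) :
      ∑ e : {v : V // v ≠ 0}, g (u • (e : V)) = ∑ v, g v - g 0 := by
    have hfull : ∑ v : V, g (u • v) = ∑ v, g v :=
      Equiv.sum_comp (MulAction.toPerm (Units.mk0 u hu)) g
    rw [← Finset.sum_subtype (Finset.univ.erase (0 : V)) (by simp) (fun v => g (u • v)),
      Finset.sum_erase_eq_sub (Finset.mem_univ _), hfull, smul_zero]
  rw [Fintype.sum_prod_type, ← Finset.add_sum_erase _ _ (Finset.mem_univ (0 : F)),
    Finset.sum_congr rfl (fun u hu => hunit u (Finset.ne_of_mem_erase hu))]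
  simp only [zero_smul, Finset.sum_const, Finset.card_univ, nsmul_eq_mul, card_nonzero,
    Finset.card_erase_of_mem (Finset.mem_univ (0 : F))]
  rw [Nat.cast_sub Fintype.card_pos]
  push_cast
  ring

/-- The first `M` power sums of the vectors `x k` at the points `β k`, weighted by `c k`, vanish. -/
def PowerSumsVanish {F V : Type*} [Field F] [AddCommGroup V] [Module F V] {t : ℕ} (M : ℕ)
    (c β : Fin t → F) (x : Fin t → V) : Prop :=
  ∀ a < M, ∑ k, (c k * β k ^ a) • x k = 0

open scoped Classical in
/-- Bound on the number of scalings `u` and patterns `e` of nonzero columns for which the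
first `M` weighted power sums of the columns `u k • e k` vanish. -/
theorem sum_powerSumsVanish_le {F V : Type*} [Field F] [Fintype F] [AddCommGroup V] [Module F V]
    [Fintype V] [Fintype {v : V // v ≠ 0}] (hcard : Fintype.card F ≤ Fintype.card V) (t M : ℕ)
    (β c : Fin t → F) (hβ : Function.Injective β) (hc : ∀ k, c k ≠ 0) :
    ∑ z : Fin t → F × {v : V // v ≠ 0},
        (if PowerSumsVanish M c β (fun k => (z k).1 • ((z k).2 : V)) then (1 : ℝ) else 0) ≤
      ((Fintype.card V : ℝ) - 1) ^ t *
        (1 + (Fintype.card F : ℝ) ^ t / (Fintype.card V : ℝ) ^ M) := by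
  have hq : (1 : ℝ) < Fintype.card F := by exact_mod_cast Fintype.one_lt_card
  have hqQ : (Fintype.card F : ℝ) ≤ Fintype.card V := by exact_mod_cast hcard
  have hQ0 : (0 : ℝ) < Fintype.card V := by linarith
  induction t generalizing M with
  | zero => simp [PowerSumsVanish]
  | succ t ih =>
    cases M with
    | zero =>
      have h := sum_smul_nonzero (F := F) (V := V) (fun _ => 1)
      simp only [Finset.sum_const, Finset.card_univ, nsmul_eq_mul, mul_one] at h
      simp only [PowerSumsVanish, not_lt_zero, IsEmpty.forall_iff, implies_true, if_true,
        Finset.sum_const, Finset.card_univ, nsmul_eq_mul, mul_one, Fintype.card_fun, Nat.cast_pow, h, pow_zero,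
        div_one, Fintype.card_fin]
      rw [show (Fintype.card V : ℝ) - Fintype.card F + (Fintype.card F - 1) * Fintype.card V =
        (Fintype.card V - 1) * Fintype.card F by ring, mul_pow]
      gcongr
      · exact pow_nonneg (by linarith) _
      · linarith
    | succ M =>
      have hβ' : Function.Injective (fun k : Fin t => β k.succ) :=
        hβ.comp (Fin.succ_injective t)
      have ih₁ := ih (M + 1) (fun k => β k.succ) (fun k => c k.succ) hβ' (fun k => hc _)
      have ih₂ := ih M (fun k => β k.succ) (fun k => c k.succ * (β k.succ - β 0)) hβ'
        (fun k => mul_ne_zero (hc _) (sub_ne_zero.2 (hβ.ne (Fin.succ_ne_zero k))))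
      rw [← (Fin.consEquiv (fun _ => F × {v : V // v ≠ 0})).sum_comp, Fintype.sum_prod_type_right]
      simp only [Fin.consEquiv_apply]
      have hstep (z : Fin t → F × {v : V // v ≠ 0}) :
          ∑ y : F × {v : V // v ≠ 0},
            (if PowerSumsVanish (M + 1) c β (fun k => ((Fin.cons y z : Fin (t + 1) → _) k).1 •
              (((Fin.cons y z : Fin (t + 1) → _) k).2 : V)) then (1 : ℝ) else 0) ≤
          ((Fintype.card V : ℝ) - Fintype.card F) *
            (if PowerSumsVanish (M + 1) (fun k => c k.succ) (fun k => β k.succ)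
              (fun k => (z k).1 • ((z k).2 : V)) then (1 : ℝ) else 0) +
          ((Fintype.card F : ℝ) - 1) *
            (if PowerSumsVanish M (fun k => c k.succ * (β k.succ - β 0)) (fun k => β k.succ)
              (fun k => (z k).1 • ((z k).2 : V)) then (1 : ℝ) else 0) := by
        simp only [PowerSumsVanish, Fin.sum_univ_succ, Fin.cons_zero, Fin.cons_succ]
        rw [sum_smul_nonzero (fun v : V => if ∀ a < M + 1, (c 0 * β 0 ^ a) • v +
              ∑ k : Fin t, (c k.succ * β k.succ ^ a) • (z k).1 • ((z k).2 : V) = 0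
              then (1 : ℝ) else 0)]
        simp only [smul_zero, zero_add]
        refine add_le_add_right (mul_le_mul_of_nonneg_left ?_ (by linarith)) _
        rw [Finset.sum_boole]
        split_ifs with hz
        · norm_cast
          refine Finset.card_le_one.2 fun v hv w hw => ?_
          have hv0 := (Finset.mem_filter.1 hv).2 0 (Nat.succ_pos M)
          have hw0 := (Finset.mem_filter.1 hw).2 0 (Nat.succ_pos M)
          have h := add_right_cancel (hv0.trans hw0.symm)
          exact (smul_right_injective V (by simpa using hc 0)) h
        · norm_cast
          rw [Nat.le_zero, Finset.card_eq_zero, Finset.filter_eq_empty_iff]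
          refine fun v _ hv => hz fun a ha => ?_
          have h₁ := hv (a + 1) (by omega)
          have h₀ := hv a (by omega)
          have hsplit : ∑ k : Fin t, (c k.succ * (β k.succ - β 0) * β k.succ ^ a) •
              (z k).1 • ((z k).2 : V) =
            ((c 0 * β 0 ^ (a + 1)) • v +
              ∑ k : Fin t, (c k.succ * β k.succ ^ (a + 1)) • (z k).1 • ((z k).2 : V)) -
            β 0 • ((c 0 * β 0 ^ a) • v +
              ∑ k : Fin t, (c k.succ * β k.succ ^ a) • (z k).1 • ((z k).2 : V)) := by
            rw [smul_add, smul_smul, Finset.smul_sum,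
              show β 0 * (c 0 * β 0 ^ a) = c 0 * β 0 ^ (a + 1) by ring, add_sub_add_left_eq_sub,
              ← Finset.sum_sub_distrib]
            refine Finset.sum_congr rfl fun k _ => ?_
            rw [smul_smul (β 0), ← sub_smul]
            congr 1
            ring
          rw [hsplit, h₁, h₀, smul_zero, sub_zero]
      refine (Finset.sum_le_sum fun z _ => hstep z).trans ?_
      rw [Finset.sum_add_distrib, ← Finset.mul_sum, ← Finset.mul_sum]
      refine (add_le_add (mul_le_mul_of_nonneg_left ih₁ (by linarith))
        (mul_le_mul_of_nonneg_left ih₂ (by linarith))).trans (le_of_eq ?_)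
      field_simp
      ring

/-- The stacked syndrome matrix of the error pattern `e` does not have full column rank. -/
def IsRankDeficient {F : Type*} [Field F] {L t : ℕ} (M : ℕ) (β : Fin t → F)
    (e : Fin t → Fin L → F) : Prop :=
  (Matrix.of fun (p : Fin L × Fin M) (b : Fin t) =>
    ∑ k, e k p.1 * β k ^ ((p.2 : ℕ) + (b : ℕ))).rank < t

/-- A rank-deficient stacked syndrome matrix gives a nonzero scaling of the error columns
whose power sums vanish. -/
theorem exists_scaling_of_isRankDeficient {F : Type*} [Field F] {L M t : ℕ} {β : Fin t → F}
    (hβ : Function.Injective β) (e : Fin t → Fin L → F)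
    (h : IsRankDeficient M β e) :
    ∃ u : Fin t → F, u ≠ 0 ∧ ∀ a < M, ∑ k, β k ^ a • u k • e k = 0 := by
  obtain ⟨v, hv0, hv⟩ : ∃ v : Fin t → F, v ≠ 0 ∧ (Matrix.of fun (p : Fin L × Fin M) (b : Fin t) =>
      ∑ k, e k p.1 * β k ^ ((p.2 : ℕ) + (b : ℕ))).mulVec v = 0 := by
    by_contra! hcon
    refine h.ne (?_ : Matrix.rank _ = t)
    rw [Matrix.rank, LinearMap.finrank_range_of_inj, Module.finrank_fin_fun]
    rw [← LinearMap.ker_eq_bot, LinearMap.ker_eq_bot']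
    intro v hv
    by_contra hv0
    exact hcon v hv0 hv
  refine ⟨(Matrix.vandermonde β).mulVec v, fun hu => hv0 ?_, fun a ha => funext fun l => ?_⟩
  · exact Matrix.eq_zero_of_mulVec_eq_zero (Matrix.det_vandermonde_ne_zero_iff.2 hβ) hu
  · have := congrFun hv (l, ⟨a, ha⟩)
    simp only [Matrix.mulVec, dotProduct, Matrix.of_apply, Pi.zero_apply, Finset.sum_mul] at this
    rw [Finset.sum_comm] at this
    simp only [Finset.sum_apply, Pi.smul_apply, smul_eq_mul, Pi.zero_apply, Matrix.mulVec,
      dotProduct, Matrix.vandermonde_apply, Finset.sum_mul, Finset.mul_sum]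
    rw [← this]
    refine Finset.sum_congr rfl fun k _ => Finset.sum_congr rfl fun b _ => ?_
    ring

open scoped Classical in
theorem ncard_isRankDeficient {F : Type*} [Field F] [Fintype F] {L : ℕ} (M t : ℕ)
    (β : Fin t → F) :
    ({e : Fin t → Fin L → F | (∀ k, e k ≠ 0) ∧ IsRankDeficient M β e}.ncard : ℝ) =
      ∑ e : Fin t → {v : Fin L → F // v ≠ 0},
        if IsRankDeficient M β (fun k => (e k : Fin L → F)) then (1 : ℝ) else 0 := by
  rw [Finset.sum_boole, ← Set.ncard_coe_finset, Nat.cast_inj]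
  refine (Set.ncard_congr (fun e _ k => (e k : Fin L → F)) ?_ ?_ ?_).symm
  · intro e he
    exact ⟨fun k => (e k).2, by simpa using he⟩
  · intro e e' _ _ h
    exact funext fun k => Subtype.ext (congrFun h k)
  · rintro e ⟨he, hf⟩
    exact ⟨fun k => ⟨e k, he k⟩, by simpa using hf, rfl⟩

open scoped Classical in
/-- Every pattern admits the zero scaling, and a rank-deficient one admits a line of scalings. -/
theorem one_add_le_sum_scalings {F : Type*} [Field F] [Fintype F] {L : ℕ} (M t : ℕ)
    {β : Fin t → F} (hβ : Function.Injective β) (e : Fin t → Fin L → F) :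
    1 + ((Fintype.card F : ℝ) - 1) * (if IsRankDeficient M β e then (1 : ℝ) else 0) ≤
      ∑ u : Fin t → F, if PowerSumsVanish M 1 β (fun k => u k • e k)
        then (1 : ℝ) else 0 := by
  rw [Finset.sum_boole]
  split_ifs with hf
  · obtain ⟨u, hu, hsum⟩ := exists_scaling_of_isRankDeficient hβ _ hf
    rw [mul_one, add_sub_cancel, Nat.cast_le, ← Finset.card_univ]
    refine Finset.card_le_card_of_injOn (fun s : F => s • u) (fun s _ => ?_)
      (smul_left_injective F hu).injOn
    simp only [Finset.coe_filter, Finset.mem_univ, true_and, Set.mem_ofPred_eq]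
    intro a ha
    have h := congrArg (s • ·) (hsum a ha)
    simp only [Finset.smul_sum, smul_zero] at h
    refine (Finset.sum_congr rfl fun k _ => ?_).trans h
    simp only [Pi.one_apply, one_mul, Pi.smul_apply, smul_eq_mul, smul_smul]
    congr 1
    ring
  · rw [mul_zero, add_zero, Nat.one_le_cast, Nat.one_le_iff_ne_zero, ← Nat.pos_iff_ne_zero,
      Finset.card_pos]
    exact ⟨0, by simp [PowerSumsVanish]⟩

open scoped Classical in
/-- Counting form of the failure bound. -/
theorem ncard_isRankDeficient_le {F : Type*} [Field F] [Fintype F] {L : ℕ} (hL : 1 ≤ L) (M t : ℕ)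
    {β : Fin t → F} (hβ : Function.Injective β) :
    ((Fintype.card F : ℝ) - 1) *
      ({e : Fin t → Fin L → F | (∀ k, e k ≠ 0) ∧ IsRankDeficient M β e}.ncard : ℝ) ≤
      ((Fintype.card F : ℝ) ^ L - 1) ^ t *
        ((Fintype.card F : ℝ) ^ t / ((Fintype.card F : ℝ) ^ L) ^ M) := by
  have hV : Fintype.card (Fin L → F) = Fintype.card F ^ L := by simp
  have hbound := sum_powerSumsVanish_le (F := F) (V := Fin L → F)
    (by rw [hV]; exact Nat.le_self_pow (by omega) _) t M β 1 hβ (by simp)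
  rw [hV, Nat.cast_pow] at hbound
  have hcardE : (Fintype.card {v : Fin L → F // v ≠ 0} : ℝ) = (Fintype.card F : ℝ) ^ L - 1 := by
    rw [card_nonzero, hV, Nat.cast_pow]
  have hlow : ((Fintype.card F : ℝ) ^ L - 1) ^ t + ((Fintype.card F : ℝ) - 1) *
      ({e : Fin t → Fin L → F | (∀ k, e k ≠ 0) ∧ IsRankDeficient M β e}.ncard : ℝ) ≤
      ∑ e : Fin t → {v : Fin L → F // v ≠ 0}, ∑ u : Fin t → F,
        if PowerSumsVanish M 1 β (fun k => u k • (e k : Fin L → F))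
        then (1 : ℝ) else 0 := by
    refine le_trans (le_of_eq ?_)
      (Finset.sum_le_sum fun e _ => one_add_le_sum_scalings M t hβ (fun k => (e k : Fin L → F)))
    rw [Finset.sum_add_distrib, ← Finset.mul_sum, ncard_isRankDeficient]
    simp only [Finset.sum_const, Finset.card_univ, nsmul_eq_mul, mul_one, Fintype.card_fun,
      Nat.cast_pow, hcardE, Fintype.card_fin]
  rw [← Fintype.sum_prod_type_right' (fun (u : Fin t → F) (e : Fin t → {v : Fin L → F // v ≠ 0}) =>
      if PowerSumsVanish M 1 β (fun k => u k • (e k : Fin L → F))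
        then (1 : ℝ) else 0)] at hlow
  have hsplit := Fintype.sum_equiv
    (Equiv.arrowProdEquivProdArrow (Fin t) (fun _ => F) (fun _ => {v : Fin L → F // v ≠ 0}))
    (fun z => if PowerSumsVanish M 1 β (fun k => (z k).1 • ((z k).2 : Fin L → F))
        then (1 : ℝ) else 0)
    (fun p => if PowerSumsVanish M 1 β (fun k => p.1 k • (p.2 k : Fin L → F))
        then (1 : ℝ) else 0) (fun _ => rfl)
  have := hlow.trans (hsplit.symm.le.trans hbound)
  linarith

/-- Schmidt et al.'s bound on the probability of decoding failure of the collaborative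
IRS decoder under the uniform random error model: failure (rank-deficient stacked
syndrome matrix) occurs for at most a fraction
((q^L - 1/q)/(q^L - 1)) · q^{-(L+1)(t_max - t)}/(q-1) of the error patterns. -/
theorem IRS_failure_probability_bound (Fq : Type) [Field Fq] [Fintype Fq]
    (N K L t : ℕ) (hK : K < N) (hL : 1 ≤ L) (ht : 0 < t)
    (htmax : (t : ℝ) ≤ (L : ℝ) * ((N : ℝ) - (K : ℝ)) / ((L : ℝ) + 1))
    (β : Fin t → Fq) (hβ : Function.Injective β) (hβ0 : ∀ k, β k ≠ 0) :
    ({e : Fin t → Fin L → Fq | (∀ k, e k ≠ 0) ∧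
        (Matrix.of fun (p : Fin L × Fin (N - K - t)) (b : Fin t) =>
          ∑ k, e k p.1 * β k ^ ((p.2 : ℕ) + (b : ℕ))).rank < t}.ncard : ℝ) /
      ({e : Fin t → Fin L → Fq | ∀ k, e k ≠ 0}.ncard : ℝ) ≤
    (((Fintype.card Fq : ℝ) ^ L - 1 / (Fintype.card Fq : ℝ)) /
        ((Fintype.card Fq : ℝ) ^ L - 1)) *
      ((Fintype.card Fq : ℝ) ^
          (-((L : ℝ) + 1) * ((L : ℝ) * ((N : ℝ) - (K : ℝ)) / ((L : ℝ) + 1) - (t : ℝ))) /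
        ((Fintype.card Fq : ℝ) - 1)) := by
  set q : ℝ := (Fintype.card Fq : ℝ) with hq_def
  have hq : 1 < q := by rw [hq_def]; exact_mod_cast Fintype.one_lt_card
  have hq0 : 0 < q := by linarith
  have hQ : 1 < q ^ L := one_lt_pow₀ hq (by omega)
  have hLpos : (0 : ℝ) < (L : ℝ) + 1 := by positivity
  have htNK : t + K ≤ N := by
    rw [le_div_iff₀ hLpos] at htmax
    have hKN : (K : ℝ) < N := by exact_mod_cast hK
    have : (t : ℝ) + K ≤ N := by
      by_contra! hcon
      nlinarith
    exact_mod_cast this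
  have hM : ((N - K - t : ℕ) : ℝ) = (N : ℝ) - K - t := by
    rw [Nat.cast_sub (by omega), Nat.cast_sub hK.le]
  have hcount := ncard_isRankDeficient_le hL (N - K - t) t hβ
  simp only [IsRankDeficient, ← hq_def] at hcount
  have htotal : ({e : Fin t → Fin L → Fq | ∀ k, e k ≠ 0}.ncard : ℝ) = (q ^ L - 1) ^ t := by
    classical
    have hset : {e : Fin t → Fin L → Fq | ∀ k, e k ≠ 0} =
        ↑(Fintype.piFinset fun _ : Fin t => ({0}ᶜ : Finset (Fin L → Fq))) := by
      ext e
      simp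
    rw [hset, Set.ncard_coe_finset, Fintype.card_piFinset, Finset.prod_const, Finset.card_compl,
      Finset.card_singleton, Finset.card_univ, Fintype.card_fin, Fintype.card_fun, Fintype.card_fin,
      Nat.cast_pow, Nat.cast_sub (Nat.one_le_pow _ _ Fintype.card_pos), Nat.cast_pow, Nat.cast_one]
  have hpow : q ^ (-((L : ℝ) + 1) * ((L : ℝ) * ((N : ℝ) - (K : ℝ)) / ((L : ℝ) + 1) - (t : ℝ))) =
      q ^ t / (q ^ L) ^ (N - K - t) := by
    rw [show -((L : ℝ) + 1) * ((L : ℝ) * ((N : ℝ) - (K : ℝ)) / ((L : ℝ) + 1) - (t : ℝ)) =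
      (t : ℝ) - ((L * (N - K - t) : ℕ) : ℝ) by
        rw [Nat.cast_mul, hM]
        field_simp
        ring, Real.rpow_sub hq0, Real.rpow_natCast, Real.rpow_natCast, pow_mul]
  have hfactor : 1 ≤ (q ^ L - 1 / q) / (q ^ L - 1) := by
    rw [one_le_div (by linarith)]
    have : 1 / q ≤ 1 := (div_le_one hq0).2 hq.le
    linarith
  have hnonneg : 0 ≤ q ^ t / (q ^ L) ^ (N - K - t) / (q - 1) :=
    div_nonneg (by positivity) (by linarith)
  rw [htotal, hpow]
  refine le_trans ?_ (le_mul_of_one_le_left hnonneg hfactor)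
  rw [div_le_div_iff₀ (pow_pos (by linarith) t) (by linarith)]
  linarith
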